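/- Assume there exists a continuous ω = (ω_2,…,ω_m) : U → ℝ^{m−1} such that D^φφ = ω in the broad* sense on U. Then φ is vertically broad* Hölder on U. -/

import Mathlib

open MeasureTheory Filter Topology

namespace Step2

/-- The underlying space of the step-2 Carnot group `G = ℝ^m × ℝ^h`. -/
abbrev G (m h : ℕ) := (Fin m → ℝ) × (Fin h → ℝ)

variable {m h : ℕ}

/-- Group product `(x,y)·(x',y') = (x+x', y+y' - (1/2)⟨Bx,x'⟩)`. -/
noncomputable def gmul (B : Fin h → Matrix (Fin m) (Fin m) ℝ) (p q : G m h) : G m h :=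
  (p.1 + q.1, fun i => p.2 i + q.2 i - (1 / 2) * ∑ j, ∑ k, B i j k * p.1 k * q.1 j)

/-- Group inverse `g⁻¹ = -g`. -/
def ginv (p : G m h) : G m h := (-p.1, -p.2)

/-- Homogeneous norm `‖(x,y)‖ = Σ|x_j| + Σ|y_i|^(1/2)`. -/
noncomputable def hnorm (p : G m h) : ℝ :=
  (∑ j, |p.1 j|) + ∑ i, Real.sqrt |p.2 i|

/-- Homogeneous (quasi-)distance `d(p,q) = ‖p⁻¹·q‖`. -/
noncomputable def gdist (B : Fin h → Matrix (Fin m) (Fin m) ℝ) (p q : G m h) : ℝ :=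
  hnorm (gmul B (ginv p) q)

/-- Euclidean distance on `G`. -/
noncomputable def eDist (p q : G m h) : ℝ :=
  Real.sqrt ((∑ j, (p.1 j - q.1 j) ^ 2) + ∑ i, (p.2 i - q.2 i) ^ 2)

/-- The subgroup `W = {x_1 = 0}`. -/
def Wset (m h : ℕ) [NeZero m] : Set (G m h) := {p | p.1 0 = 0}

/-- `U` is (relatively) open in `W`. -/
def RelOpen (m h : ℕ) [NeZero m] (U : Set (G m h)) : Prop :=
  ∃ O : Set (G m h), IsOpen O ∧ U = O ∩ Wset m h

/-- The graphing map `Φ(w) = (φ(w),0,…,0) ∈ L`. -/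
noncomputable def Phi [NeZero m] (φ : G m h → ℝ) (w : G m h) : G m h :=
  ((fun j => if j = 0 then φ w else 0), 0)

/-- Horizontal coordinate vector `e_{x_j}`. -/
def eH (m h : ℕ) (j : Fin m) : G m h := ((fun j' => if j' = j then 1 else 0), 0)

/-- Vertical coordinate vector `e_{y_i}`. -/
def eV (m h : ℕ) (i : Fin h) : G m h := (0, fun i' => if i' = i then 1 else 0)

/-- The projected vector field `D^φ_j` (for `j ≠ 0`, i.e. `j = 2,…,m` in 1-based indexing):
`D^φ_j|_w = ∂_{x_j} - Σ_i ( b^(i)_{j1} φ(w) + (1/2) Σ_{k≥2} x_k b^(i)_{jk} ) ∂_{y_i}`. -/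
noncomputable def Dvec [NeZero m] (B : Fin h → Matrix (Fin m) (Fin m) ℝ)
    (φ : G m h → ℝ) (j : Fin m) (w : G m h) : G m h :=
  ((fun j' => if j' = j then 1 else 0),
   fun i => -(B i j 0 * φ w
      + (1 / 2) * ∑ k ∈ Finset.univ.erase (0 : Fin m), w.1 k * B i j k))

/-- `D^φφ = ω` in the broad* sense on `U`. -/
def IsBroadStar [NeZero m] (B : Fin h → Matrix (Fin m) (Fin m) ℝ) (U : Set (G m h))
    (φ : G m h → ℝ) (ω : G m h → Fin m → ℝ) : Prop :=
  ∀ a₀ ∈ U, ∃ δ₁ δ₂ : ℝ, 0 < δ₂ ∧ δ₂ < δ₁ ∧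
    ∀ j : Fin m, j ≠ 0 → ∃ E : G m h → ℝ → G m h,
      ∀ a, a ∈ U → eDist a a₀ ≤ δ₂ →
        (∀ t ∈ Set.Icc (-δ₂) δ₂, E a t ∈ U ∧ eDist (E a t) a₀ ≤ δ₁) ∧
        E a 0 = a ∧
        (∀ t ∈ Set.Icc (-δ₂) δ₂,
          HasDerivWithinAt (E a) (Dvec B φ j (E a t)) (Set.Icc (-δ₂) δ₂) t) ∧
        (∀ t ∈ Set.Icc (-δ₂) δ₂, φ (E a t) - φ a = ∫ s in (0:ℝ)..t, ω (E a s) j)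

/-- `φ` is vertically broad* Hölder on `U`. -/
def VertHolder (m h : ℕ) [NeZero m] (U : Set (G m h)) (φ : G m h → ℝ) : Prop :=
  ∀ a₀ ∈ U, ∃ U' : Set (G m h), RelOpen m h U' ∧ a₀ ∈ U' ∧
    IsCompact (closure U') ∧ closure U' ⊆ U ∧
    ∀ i : Fin h, ∀ ε > (0:ℝ), ∃ ρ > (0:ℝ), ∀ p ∈ U', ∀ q ∈ U',
      p.1 = q.1 → (∀ i' : Fin h, i' ≠ i → p.2 i' = q.2 i') →
      0 < |p.2 i - q.2 i| → |p.2 i - q.2 i| ≤ ρ →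
      |φ p - φ q| ≤ ε * Real.sqrt |p.2 i - q.2 i|

/-- The translated point `Φ(a)⁻¹·a⁻¹·b·Φ(a)`. -/
noncomputable def shiftQ [NeZero m] (B : Fin h → Matrix (Fin m) (Fin m) ℝ)
    (φ : G m h → ℝ) (a b : G m h) : G m h :=
  gmul B (gmul B (gmul B (ginv (Phi φ a)) (ginv a)) b) (Phi φ a)

/-- `φ` is intrinsically differentiable at `a₀` with intrinsic gradient `grad`. -/
def IDAt [NeZero m] (B : Fin h → Matrix (Fin m) (Fin m) ℝ) (U : Set (G m h))
    (φ : G m h → ℝ) (a₀ : G m h) (grad : Fin m → ℝ) : Prop :=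
  ∀ ε > (0:ℝ), ∃ r > (0:ℝ), ∀ b ∈ U, 0 < gdist B a₀ b → gdist B a₀ b < r →
    |φ b - φ a₀ - ∑ j ∈ Finset.univ.erase (0 : Fin m), grad j * (b.1 j - a₀.1 j)|
      ≤ ε * hnorm (shiftQ B φ a₀ b)

/-- `φ` is uniformly intrinsically differentiable at `a₀` with intrinsic gradient `grad`. -/
def UIDAt [NeZero m] (B : Fin h → Matrix (Fin m) (Fin m) ℝ) (U : Set (G m h))
    (φ : G m h → ℝ) (a₀ : G m h) (grad : Fin m → ℝ) : Prop :=
  ∀ ε > (0:ℝ), ∃ r > (0:ℝ), ∀ a ∈ U, ∀ b ∈ U,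
    gdist B a₀ a < r → gdist B a₀ b < r → a ≠ b →
    |φ b - φ a - ∑ j ∈ Finset.univ.erase (0 : Fin m), grad j * (b.1 j - a.1 j)|
      ≤ ε * hnorm (shiftQ B φ a b)

/-- Projection onto `L` in the splitting `G = W·L`. -/
def piL (m h : ℕ) [NeZero m] (g : G m h) : G m h :=
  ((fun j => if j = 0 then g.1 0 else 0), 0)

/-- Projection onto `W` in the splitting `G = W·L`. -/
noncomputable def piW [NeZero m] (B : Fin h → Matrix (Fin m) (Fin m) ℝ) (g : G m h) : G m h :=
  ((fun j => if j = 0 then 0 else g.1 j),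
   fun i => g.2 i + (1 / 2) * g.1 0 * ∑ k ∈ Finset.univ.erase (0 : Fin m), B i 0 k * g.1 k)

/-- Coordinates `ℝ^(m-1) × ℝ^h → W ⊆ G`. -/
def emb (m h : ℕ) (u : (Fin (m - 1) → ℝ) × (Fin h → ℝ)) : G m h :=
  ((fun j => if hj : (j : ℕ) = 0 then 0
      else u.1 ⟨(j : ℕ) - 1, by have := j.isLt; omega⟩), u.2)

/-- The Lebesgue measure on `W`, as a measure on `G`. -/
noncomputable def muW (m h : ℕ) : Measure (G m h) :=
  Measure.map (emb m h) volume

end Step2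

namespace Step2

/-- A point `a` of `W`, moved for time `t` along a projected vector field `D^φ_j` (`j ≠ 0`)
with `∫ φ = s` along the way. -/
noncomputable def flowPoint {m h : ℕ} [NeZero m] (B : Fin h → Matrix (Fin m) (Fin m) ℝ)
    (j : Fin m) (a : G m h) (t s : ℝ) : G m h :=
  (a.1 + t • Pi.single j 1,
    fun i => a.2 i - s * B i j 0 - t * ((1 / 2) * ∑ k, a.1 k * B i j k))

/-- The column of coefficients `(b^(i)_{jk})_i`, as a vertical vector. -/
def coeffVec {m h : ℕ} (B : Fin h → Matrix (Fin m) (Fin m) ℝ) (j k : Fin m) : Fin h → ℝ :=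
  fun i => B i j k

section Calculus

theorem abs_sub_le_of_hasDerivAt {F f : ℝ → ℝ} {c K t : ℝ}
    (hF : ∀ s, |s| ≤ |t| → HasDerivAt F (f s) s) (hf : ∀ s, |s| ≤ |t| → |f s - c| ≤ K) :
    |F t - F 0 - t * c| ≤ K * |t| := by
  have key := Convex.norm_image_sub_le_of_norm_hasDerivWithin_le (𝕜 := ℝ)
    (f := fun s => F s - s * c) (f' := fun s => f s - c) (s := Set.Icc (-|t|) |t|)
    (x := 0) (y := t) (C := K)
    (fun s hs => by
      simpa using ((hF s (abs_le.2 hs)).fun_sub ((hasDerivAt_id s).mul_const c)).hasDerivWithinAt)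
    (fun s hs => hf s (abs_le.2 hs)) (convex_Icc _ _) (by simp) (abs_le.1 le_rfl)
  simp only [Real.norm_eq_abs, zero_mul, sub_zero] at key
  convert key using 2
  ring

/-- A primitive of a function that stays close to a large constant `Δ` attains every
small value. -/
theorem exists_eq_of_derivative_near_const {H f : ℝ → ℝ} {T d Δ : ℝ} (hT : 0 < T)
    (hH0 : H 0 = 0) (hH : ∀ t, |t| ≤ T → HasDerivAt H (f t) t)
    (hf : ∀ t, |t| ≤ T → |f t - Δ| ≤ |Δ| / 2) (hd : |d| ≤ |Δ| / 2 * T) :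
    ∃ t, |t| ≤ T ∧ H t = d := by
  have hcont : ContinuousOn H (Set.uIcc (-T) T) := by
    rw [Set.uIcc_of_le (by linarith)]
    intro t ht
    exact (hH t (abs_le.2 ht)).continuousAt.continuousWithinAt
  have h1 := abs_le.1 (abs_sub_le_of_hasDerivAt (F := H) (t := T) (fun s hs => hH s (by
    rwa [abs_of_pos hT] at hs)) (fun s hs => hf s (by rwa [abs_of_pos hT] at hs)))
  have h2 := abs_le.1 (abs_sub_le_of_hasDerivAt (F := H) (t := -T) (fun s hs => hH s (by
    rwa [abs_neg, abs_of_pos hT] at hs))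
      (fun s hs => hf s (by rwa [abs_neg, abs_of_pos hT] at hs)))
  rw [abs_neg, abs_of_pos hT, hH0] at h2
  rw [abs_of_pos hT, hH0] at h1
  have hd' := abs_le.1 hd
  have hmem : d ∈ Set.uIcc (H (-T)) (H T) := by
    rw [Set.mem_uIcc]
    rcases le_total 0 Δ with h | h
    · rw [abs_of_nonneg h] at *
      left; constructor <;> nlinarith
    · rw [abs_of_nonpos h] at *
      right; constructor <;> nlinarith
  obtain ⟨t, ht, htd⟩ := intermediate_value_uIcc hcont hmem
  rw [Set.uIcc_of_le (by linarith)] at ht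
  exact ⟨t, abs_le.2 ht, htd⟩

/-- A curve whose velocity is bounded by `C` near its starting point stays close to it. -/
theorem norm_sub_le_of_norm_deriv_lt {E : Type*} [NormedAddCommGroup E] [NormedSpace ℝ E]
    {γ γ' : ℝ → E} {τ C r : ℝ} (hC : 0 < C) (hr : C * τ ≤ r)
    (hγ : ∀ t ∈ Set.Icc (-τ) τ, HasDerivWithinAt γ (γ' t) (Set.Icc (-τ) τ) t)
    (hbound : ∀ t ∈ Set.Icc (-τ) τ, ‖γ t - γ 0‖ ≤ r → ‖γ' t‖ < C)
    {t : ℝ} (ht : t ∈ Set.Icc (-τ) τ) : ‖γ t - γ 0‖ ≤ C * |t| := by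
  have main : ∀ (δ δ' : ℝ → E),
      (∀ t ∈ Set.Icc (-τ) τ, HasDerivWithinAt δ (δ' t) (Set.Icc (-τ) τ) t) →
      (∀ t ∈ Set.Icc (-τ) τ, ‖δ t - δ 0‖ ≤ r → ‖δ' t‖ < C) →
      ∀ t ∈ Set.Icc 0 τ, ‖δ t - δ 0‖ ≤ C * t := by
    intro δ δ' hδ hb t ht
    have hsub : Set.Icc 0 τ ⊆ Set.Icc (-τ) τ :=
      Set.Icc_subset_Icc (by linarith [ht.1, ht.2]) le_rfl
    refine image_norm_le_of_norm_deriv_right_lt_deriv_boundary (f := fun t => δ t - δ 0)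
      (f' := δ') (a := 0) (b := τ) (B := fun t => C * t) (B' := fun _ => C)
      ?_ ?_ (by simp) ?_ ?_ ht
    · intro s hs
      exact (((hδ s (hsub hs)).continuousWithinAt).mono hsub).sub continuousWithinAt_const
    · intro s hs
      have h1 := (hδ s (hsub ⟨hs.1, hs.2.le⟩)).sub_const (δ 0)
      exact h1.mono_of_mem_nhdsWithin
        (mem_of_superset (Icc_mem_nhdsGE hs.2)
          (Set.Icc_subset_Icc (by linarith [hs.1, hs.2]) le_rfl))
    · intro s
      simpa using (hasDerivAt_id s).const_mul C
    · intro s hs hs'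
      refine hb s (hsub ⟨hs.1, hs.2.le⟩) ?_
      rw [hs']
      exact (mul_le_mul_of_nonneg_left hs.2.le hC.le).trans hr
  rcases le_total 0 t with h0 | h0
  · rw [abs_of_nonneg h0]
    exact main γ γ' hγ hbound t ⟨h0, ht.2⟩
  · rw [abs_of_nonpos h0]
    have hneg : ∀ s ∈ Set.Icc (-τ) τ, -s ∈ Set.Icc (-τ) τ := fun s hs =>
      ⟨by linarith [hs.2], by linarith [hs.1]⟩
    have := main (fun s => γ (-s)) (fun s => -γ' (-s)) (fun s hs => by
        have := HasDerivWithinAt.scomp s (hγ (-s) (hneg s hs))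
          ((hasDerivAt_neg s).hasDerivWithinAt (s := Set.Icc (-τ) τ)) hneg
        simpa [Function.comp_def] using this)
      (fun s hs h => by
        rw [norm_neg]
        exact hbound (-s) (hneg s hs) (by simpa using h))
      (-t) ⟨by linarith, by linarith [ht.1]⟩
    simpa using this

/-- A function which is continuous along a compact interval has a primitive there. -/
theorem exists_primitive_of_continuousOn {f : ℝ → ℝ} {δ : ℝ} (hδ : 0 ≤ δ)
    (hf : ContinuousOn f (Set.Icc (-δ) δ)) :
    ∃ F : ℝ → ℝ, F 0 = 0 ∧ ∀ t ∈ Set.Icc (-δ) δ, HasDerivAt F (f t) t := by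
  have hle : -δ ≤ δ := by linarith
  have hc : Continuous (Set.IccExtend hle ((Set.Icc (-δ) δ).domRestrict f)) :=
    (continuousOn_iff_continuous_domRestrict.1 hf).Icc_extend'
  refine ⟨fun t => ∫ s in (0 : ℝ)..t, Set.IccExtend hle ((Set.Icc (-δ) δ).domRestrict f) s,
    by simp, fun t ht => ?_⟩
  have := (hc.integral_hasStrictDerivAt 0 t).hasDerivAt
  rwa [Set.IccExtend_of_mem hle _ ht] at this

theorem abs_integral_sub_mul_le {g : ℝ → ℝ} {δ c K t : ℝ}
    (hg : ContinuousOn g (Set.Icc (-δ) δ)) (ht : |t| ≤ δ)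
    (hK : ∀ s, |s| ≤ |t| → |g s - c| ≤ K) :
    |(∫ s in (0 : ℝ)..t, g s) - t * c| ≤ K * |t| := by
  have hsub : Set.uIcc 0 t ⊆ Set.Icc (-|t|) |t| :=
    Set.uIcc_subset_Icc ⟨by simp, by simp⟩ (abs_le.1 le_rfl)
  have hint : IntervalIntegrable g volume 0 t :=
    (hg.mono (hsub.trans (Set.Icc_subset_Icc (by linarith) ht))).intervalIntegrable
  have := intervalIntegral.norm_integral_le_of_norm_le_const (a := 0) (b := t) (C := K)
    (f := fun s => g s - c) (fun s hs => hK s (abs_le.2 (hsub (Set.uIoc_subset_uIcc hs))))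
  rw [intervalIntegral.integral_sub hint (by simp)] at this
  simpa using this

end Calculus

section Flow

variable {m h : ℕ} {B : Fin h → Matrix (Fin m) (Fin m) ℝ}

theorem diag_eq_zero (hskew : ∀ i, (B i).transpose = -B i) (i : Fin h) (j : Fin m) :
    B i j j = 0 := by
  have := congrFun (congrFun (hskew i) j) j
  simp only [Matrix.transpose_apply, Matrix.neg_apply] at this
  linarith

theorem coeffVec_swap (hskew : ∀ i, (B i).transpose = -B i) (j k : Fin m) :
    coeffVec B k j = -coeffVec B j k := by
  ext i
  have := congrFun (congrFun (hskew i) j) k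
  simpa [coeffVec] using this

theorem continuous_eDist_left (a₀ : G m h) : Continuous fun a : G m h => eDist a a₀ := by
  unfold eDist
  fun_prop

variable [NeZero m]

theorem flowPoint_mem_Wset {j : Fin m} (hj : j ≠ 0) {a : G m h} (ha : a ∈ Wset m h) (t s : ℝ) :
    flowPoint B j a t s ∈ Wset m h := by
  have ha' : a.1 0 = 0 := ha
  simp [flowPoint, Wset, ha', hj.symm]

/-- Integral curves of `D^φ_j` have the form `flowPoint`. -/
theorem exists_eq_flowPoint (hskew : ∀ i, (B i).transpose = -B i) {U : Set (G m h)}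
    (hUW : U ⊆ Wset m h) {φ : G m h → ℝ} (hφ : ContinuousOn φ U) {j : Fin m}
    {δ : ℝ} (hδ : 0 < δ) {γ : ℝ → G m h} (hγU : ∀ t ∈ Set.Icc (-δ) δ, γ t ∈ U)
    (hγ : ∀ t ∈ Set.Icc (-δ) δ,
      HasDerivWithinAt γ (Dvec B φ j (γ t)) (Set.Icc (-δ) δ) t) :
    ∃ F : ℝ → ℝ, F 0 = 0 ∧ (∀ t ∈ Set.Icc (-δ) δ, HasDerivAt F (φ (γ t)) t) ∧
      ∀ t ∈ Set.Icc (-δ) δ, γ t = flowPoint B j (γ 0) t (F t) := by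
  have hcont : ContinuousOn (fun t => φ (γ t)) (Set.Icc (-δ) δ) :=
    hφ.comp (fun t ht => (hγ t ht).continuousWithinAt) hγU
  obtain ⟨F, hF0, hF⟩ := exists_primitive_of_continuousOn hδ.le hcont
  have h0 : (0 : ℝ) ∈ Set.Icc (-δ) δ := ⟨by linarith, hδ.le⟩
  have const : ∀ u : ℝ → ℝ, (∀ t ∈ Set.Icc (-δ) δ, HasDerivWithinAt u 0 (Set.Icc (-δ) δ) t) →
      ∀ t ∈ Set.Icc (-δ) δ, u t = u 0 := by
    intro u hu t ht
    have := Convex.norm_image_sub_le_of_norm_hasDerivWithin_le (𝕜 := ℝ) (C := 0) hu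
      (by simp) (convex_Icc _ _) h0 ht
    simpa [sub_eq_zero] using this
  have hx : ∀ t ∈ Set.Icc (-δ) δ, ∀ k, (γ t).1 k = (γ 0).1 k + t * (if k = j then 1 else 0) := by
    intro t ht k
    have := const (fun t => (γ t).1 k - t * (if k = j then 1 else 0)) (fun s hs => by
      have h1 := (hasDerivWithinAt_pi.1 (hγ s hs).fst) k
      simpa [Dvec] using
        h1.fun_sub ((hasDerivWithinAt_id s _).mul_const (if k = j then (1 : ℝ) else 0))) t ht
    simp only [zero_mul, sub_zero] at this
    linarith
  refine ⟨F, hF0, hF, fun t ht => ?_⟩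
  have hsum : ∀ s ∈ Set.Icc (-δ) δ, ∀ i,
      ∑ k ∈ Finset.univ.erase (0 : Fin m), (γ s).1 k * B i j k = ∑ k, (γ 0).1 k * B i j k := by
    intro s hs i
    have hW : (γ s).1 0 = 0 := hUW (hγU s hs)
    rw [Finset.sum_erase _ (by simp [hW])]
    refine Finset.sum_congr rfl fun k _ => ?_
    rw [hx s hs k]
    split_ifs with hk
    · simp [hk, diag_eq_zero hskew]
    · simp
  refine Prod.ext ?_ ?_
  · ext k
    rw [hx t ht k]
    simp [flowPoint, Pi.single_apply]
  · ext i
    have := const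
      (fun t => (γ t).2 i + F t * B i j 0 + t * ((1 / 2) * ∑ k, (γ 0).1 k * B i j k))
      (fun s hs => by
        have h1 := (hasDerivWithinAt_pi.1 (hγ s hs).snd) i
        have h2 := (h1.fun_add (((hF s hs).mul_const (B i j 0)).hasDerivWithinAt)).fun_add
          ((hasDerivWithinAt_id s _).mul_const ((1 / 2) * ∑ k, (γ 0).1 k * B i j k))
        refine h2.congr_deriv ?_
        simp only [Dvec, hsum s hs i]
        ring) t ht
    simp only [hF0, zero_mul, add_zero] at this
    simp only [flowPoint]
    linarith

/-- Quantitative information on the integral curves of the fields `D^φ_j` which start near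
`a₀`: `F j a t` is the integral of `φ` along the curve of `D^φ_j` through `a`. -/
structure LocalFlow (B : Fin h → Matrix (Fin m) (Fin m) ℝ) (φ : G m h → ℝ)
    (ω : G m h → Fin m → ℝ) (a₀ : G m h) where
  R : ℝ
  C : ℝ
  τ : ℝ
  R_pos : 0 < R
  C_nonneg : 0 ≤ C
  τ_pos : 0 < τ
  F : Fin m → G m h → ℝ → ℝ
  F_zero : ∀ j ≠ 0, ∀ a ∈ Wset m h, ‖a - a₀‖ < R → F j a 0 = 0
  hasDerivAt : ∀ j ≠ 0, ∀ a ∈ Wset m h, ‖a - a₀‖ < R → ∀ t, |t| ≤ τ →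
    HasDerivAt (F j a) (φ (flowPoint B j a t (F j a t))) t
  norm_sub_le : ∀ j ≠ 0, ∀ a ∈ Wset m h, ‖a - a₀‖ < R → ∀ t, |t| ≤ τ →
    ‖flowPoint B j a t (F j a t) - a‖ ≤ C * |t|
  abs_sub_le : ∀ j ≠ 0, ∀ a ∈ Wset m h, ‖a - a₀‖ < R → ∀ t, |t| ≤ τ →
    |φ (flowPoint B j a t (F j a t)) - φ a| ≤ C * |t|
  taylor : ∀ ε > 0, ∃ δ > 0, ∀ j ≠ 0, ∀ a ∈ Wset m h, ‖a - a₀‖ < R → ∀ t, |t| ≤ τ → |t| < δ →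
    |φ (flowPoint B j a t (F j a t)) - φ a - t * ω a j| ≤ ε * |t|
  unif : ∀ ε > 0, ∃ δ > 0, ∀ j, ∀ p ∈ Wset m h, ‖p - a₀‖ < R →
    ∀ q ∈ Wset m h, ‖q - a₀‖ < R → ‖p - q‖ < δ → |ω p j - ω q j| ≤ ε

theorem continuousOn_Dvec {φ : G m h → ℝ} {U : Set (G m h)} (hφ : ContinuousOn φ U) (j : Fin m) :
    ContinuousOn (Dvec B φ j) U := by
  unfold Dvec
  fun_prop

theorem nonempty_localFlow (hskew : ∀ i, (B i).transpose = -B i) {U : Set (G m h)}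
    (hUW : U ⊆ Wset m h) (hUopen : RelOpen m h U) {φ : G m h → ℝ} (hφ : ContinuousOn φ U)
    {ω : G m h → Fin m → ℝ} (hω : ContinuousOn ω U) (hbroad : IsBroadStar B U φ ω)
    {a₀ : G m h} (ha₀ : a₀ ∈ U) :
    ∃ L : LocalFlow B φ ω a₀, ∀ p ∈ Wset m h, ‖p - a₀‖ < L.R → p ∈ U := by
  obtain ⟨O, hO, rfl⟩ := hUopen
  obtain ⟨δ₁, δ, hδ, -, hE⟩ := hbroad a₀ ha₀
  have hnear : ∀ᶠ a in 𝓝 a₀, a ∈ O ∧ eDist a a₀ ≤ δ := by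
    refine (show ∀ᶠ a in 𝓝 a₀, a ∈ O from hO.mem_nhds ha₀.1).and ?_
    refine ((continuous_eDist_left a₀).continuousAt.eventually_lt
      (continuousAt_const (y := δ)) ?_).mono fun a ha => ha.le
    simpa [eDist] using hδ
  obtain ⟨R₁, hR₁, hball⟩ := Metric.eventually_nhds_iff.1 hnear
  set r := R₁ / 4 with hr
  have hrpos : 0 < r := by positivity
  have hUnear : ∀ a ∈ Wset m h, ‖a - a₀‖ < R₁ → a ∈ O ∩ Wset m h ∧ eDist a a₀ ≤ δ := by
    intro a ha hn
    have := hball (by rwa [dist_eq_norm])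
    exact ⟨⟨this.1, ha⟩, this.2⟩
  set K : Set (G m h) := Metric.closedBall a₀ (2 * r) ∩ Wset m h with hK
  have hWclosed : IsClosed (Wset m h) :=
    isClosed_eq (by fun_prop) continuous_const
  have hKc : IsCompact K := (isCompact_closedBall a₀ (2 * r)).inter_right hWclosed
  have hKU : K ⊆ O ∩ Wset m h := fun a ha => (hUnear a ha.2 (by
    have := mem_closedBall_iff_norm.1 ha.1
    linarith)).1
  obtain ⟨M₀, hM₀⟩ := hKc.exists_bound_of_continuousOn
    (f := fun w => fun j => Dvec B φ j w)
    (continuousOn_pi.2 fun j => (continuousOn_Dvec hφ j).mono hKU)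
  obtain ⟨M₁, hM₁⟩ := hKc.exists_bound_of_continuousOn (hω.mono hKU)
  have hω_unif := Metric.uniformContinuousOn_iff.1
    (hKc.uniformContinuousOn_of_continuous (hω.mono hKU))
  choose E hE using hE
  obtain ⟨C, hC, hC₀, hC₁⟩ : ∃ C > 0, M₀ < C ∧ M₁ ≤ C :=
    ⟨|M₀| + |M₁| + 1, by positivity, by linarith [le_abs_self M₀, abs_nonneg M₁],
      by linarith [le_abs_self M₁, abs_nonneg M₀]⟩
  have hVK : ∀ a ∈ Wset m h, ‖a - a₀‖ < r → a ∈ K := fun a ha hn =>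
    ⟨mem_closedBall_iff_norm.2 (by linarith), ha⟩
  set τ := min δ (r / C) with hτ
  have hτpos : 0 < τ := by positivity
  have hCτ : C * τ ≤ r := by
    rw [mul_comm, ← le_div_iff₀ hC]
    exact min_le_right _ _
  have hτsub : Set.Icc (-τ) τ ⊆ Set.Icc (-δ) δ :=
    Set.Icc_subset_Icc (neg_le_neg (min_le_left _ _)) (min_le_left _ _)
  have hcurve : ∀ j (hj : j ≠ 0), ∀ a ∈ Wset m h, ‖a - a₀‖ < r →
      ∀ t ∈ Set.Icc (-τ) τ, E j hj a t ∈ K ∧ ‖E j hj a t - a‖ ≤ C * |t| := by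
    intro j hj a ha hn t ht
    obtain ⟨haU, haδ⟩ := hUnear a ha (by linarith)
    obtain ⟨hEU, hE0, hED, -⟩ := hE j hj a haU haδ
    have inK : ∀ t ∈ Set.Icc (-τ) τ, ‖E j hj a t - a‖ ≤ r → E j hj a t ∈ K := by
      intro t ht hle
      refine ⟨mem_closedBall_iff_norm.2 ?_, (hEU t (hτsub ht)).1.2⟩
      calc ‖E j hj a t - a₀‖ ≤ ‖E j hj a t - a‖ + ‖a - a₀‖ := norm_sub_le_norm_sub_add_norm_sub _ _ _
        _ ≤ 2 * r := by linarith
    have key := norm_sub_le_of_norm_deriv_lt (γ := E j hj a)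
      (γ' := fun t => Dvec B φ j (E j hj a t)) (r := r) hC hCτ
      (fun t ht => (hED t (hτsub ht)).mono hτsub)
      (fun t ht hle => by
        rw [hE0] at hle
        exact ((norm_le_pi_norm (fun l => Dvec B φ l (E j hj a t)) j).trans
          (hM₀ _ (inK t ht hle))).trans_lt hC₀) ht
    rw [hE0] at key
    refine ⟨inK t ht (key.trans ?_), key⟩
    exact (mul_le_mul_of_nonneg_left (abs_le.2 ht) hC.le).trans hCτ
  have hint : ∀ j (hj : j ≠ 0), ∀ a ∈ Wset m h, ‖a - a₀‖ < r → ∀ c η t : ℝ, |t| ≤ τ →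
      (∀ s, |s| ≤ |t| → |ω (E j hj a s) j - c| ≤ η) →
      |φ (E j hj a t) - φ a - t * c| ≤ η * |t| := by
    intro j hj a ha hn c η t ht hη
    obtain ⟨haU, haδ⟩ := hUnear a ha (by linarith)
    obtain ⟨hEU, hE0, hED, hEφ⟩ := hE j hj a haU haδ
    rw [hEφ t (hτsub (abs_le.1 ht))]
    refine abs_integral_sub_mul_le ?_ (ht.trans (min_le_left _ _)) hη
    exact ((continuous_apply j).comp_continuousOn hω).comp
      (fun t ht => (hED t ht).continuousWithinAt) (fun t ht => (hEU t ht).1)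
  have hflow : ∀ j a, ∃ F : ℝ → ℝ, ∀ hj : j ≠ 0, a ∈ Wset m h → ‖a - a₀‖ < r →
      F 0 = 0 ∧ ∀ t, |t| ≤ τ → HasDerivAt F (φ (E j hj a t)) t ∧
        flowPoint B j a t (F t) = E j hj a t := by
    intro j a
    by_cases hyp : j ≠ 0 ∧ a ∈ Wset m h ∧ ‖a - a₀‖ < r
    · obtain ⟨hj, ha, hn⟩ := hyp
      obtain ⟨haU, haδ⟩ := hUnear a ha (by linarith)
      obtain ⟨hEU, hE0, hED, -⟩ := hE j hj a haU haδ
      obtain ⟨F, hF0, hF, hFP⟩ := exists_eq_flowPoint hskew hUW hφ hδ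
        (fun t ht => (hEU t ht).1) hED
      refine ⟨F, fun _ _ _ => ⟨hF0, fun t ht => ?_⟩⟩
      have ht' := hτsub (abs_le.1 ht)
      refine ⟨hF t ht', ?_⟩
      rw [hFP t ht', hE0]
    · exact ⟨0, fun hj ha hn => absurd ⟨hj, ha, hn⟩ hyp⟩
  choose F hF using hflow
  refine ⟨⟨r, C, τ, hrpos, hC.le, hτpos, F, ?_, ?_, ?_, ?_, ?_, ?_⟩, ?_⟩
  · exact fun j hj a ha hn => (hF j a hj ha hn).1
  · intro j hj a ha hn t ht
    obtain ⟨h1, h2⟩ := (hF j a hj ha hn).2 t ht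
    rwa [h2]
  · intro j hj a ha hn t ht
    rw [((hF j a hj ha hn).2 t ht).2]
    exact (hcurve j hj a ha hn t (abs_le.1 ht)).2
  · intro j hj a ha hn t ht
    rw [((hF j a hj ha hn).2 t ht).2]
    have := hint j hj a ha hn 0 C t ht (fun s hs => by
      rw [sub_zero]
      exact ((norm_le_pi_norm (ω (E j hj a s)) j).trans
        (hM₁ _ (hcurve j hj a ha hn s (abs_le.1 (hs.trans ht))).1)).trans hC₁)
    simpa using this
  · intro ε hε
    obtain ⟨δ', hδ', hunif⟩ := hω_unif ε hε
    refine ⟨δ' / C, by positivity, fun j hj a ha hn t ht htδ => ?_⟩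
    rw [((hF j a hj ha hn).2 t ht).2]
    refine hint j hj a ha hn (ω a j) ε t ht (fun s hs => ?_)
    obtain ⟨hsK, hsn⟩ := hcurve j hj a ha hn s (abs_le.1 (hs.trans ht))
    have hlt : C * |s| < δ' := by
      rw [lt_div_iff₀ hC] at htδ
      nlinarith
    have := hunif _ hsK _ (hVK a ha hn) (by rw [dist_eq_norm]; exact hsn.trans_lt hlt)
    rw [dist_eq_norm] at this
    exact (norm_le_pi_norm (ω (E j hj a s) - ω a) j).trans this.le
  · intro ε hε
    obtain ⟨δ', hδ', hunif⟩ := hω_unif ε hε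
    refine ⟨δ', hδ', fun j p hp hpn q hq hqn hlt => ?_⟩
    have := hunif _ (hVK p hp hpn) _ (hVK q hq hqn) (by rwa [dist_eq_norm])
    rw [dist_eq_norm] at this
    exact (norm_le_pi_norm (ω p - ω q) j).trans this.le
  · intro p hp hpn
    exact hKU (hVK p hp hpn)

end Flow

section VerticalHolder

variable {m h : ℕ}

theorem norm_vertical (v : Fin h → ℝ) (d : ℝ) : ‖((0, d • v) : G m h)‖ = |d| * ‖v‖ := by
  simp [Prod.norm_def, norm_smul, mul_nonneg]

theorem norm_add_vertical_sub_le (p a₀ : G m h) (v : Fin h → ℝ) (d : ℝ) :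
    ‖p + (0, d • v) - a₀‖ ≤ ‖p - a₀‖ + |d| * ‖v‖ := by
  rw [← norm_vertical (m := m), add_sub_right_comm]
  exact norm_add_le _ _

/-- Linear independence of the matrices `B i` says that the coefficient vectors span. -/
theorem eq_top_of_coeffVec_mem {B : Fin h → Matrix (Fin m) (Fin m) ℝ}
    (hB : LinearIndependent ℝ B) {S : Submodule ℝ (Fin h → ℝ)}
    (hS : ∀ j k, coeffVec B j k ∈ S) : S = ⊤ := by
  by_contra hne
  obtain ⟨f, hf, hle⟩ := Submodule.exists_le_ker_of_lt_top S (lt_top_iff_ne_top.2 hne)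
  refine hf ?_
  have hzero : ∑ i, f (Pi.single i 1) • B i = 0 := by
    ext j k
    have : f (coeffVec B j k) = 0 := LinearMap.mem_ker.1 (hle (hS j k))
    rw [LinearMap.pi_apply_eq_sum_univ f] at this
    rw [Matrix.sum_apply, Matrix.zero_apply, ← this]
    refine Finset.sum_congr rfl fun i _ => ?_
    have hsingle : (fun l => if i = l then (1 : ℝ) else 0) = Pi.single i 1 := by
      ext l
      simp [Pi.single_apply, eq_comm]
    rw [Matrix.smul_apply, smul_eq_mul, smul_eq_mul, mul_comm, hsingle, coeffVec]
  have := Fintype.linearIndependent_iff.1 hB _ hzero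
  refine LinearMap.pi_ext' fun i => LinearMap.ext_ring ?_
  simpa using this i

variable [NeZero m] {B : Fin h → Matrix (Fin m) (Fin m) ℝ} {φ : G m h → ℝ}
  {ω : G m h → Fin m → ℝ} {a₀ : G m h}

theorem add_vertical_mem_Wset {p : G m h} (hp : p ∈ Wset m h) (w : Fin h → ℝ) :
    p + (0, w) ∈ Wset m h := by
  simpa [Wset] using hp

/-- `φ` is little-`1/2`-Hölder in the vertical direction `v`, locally uniformly in the ball of
radius `R` about `a₀`. -/
def LittleHolderAlong (φ : G m h → ℝ) (a₀ : G m h) (R : ℝ) (v : Fin h → ℝ) : Prop :=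
  ∀ r < R, ∀ ε > 0, ∀ᶠ d in 𝓝 (0 : ℝ), ∀ p ∈ Wset m h, ‖p - a₀‖ < r →
    |φ (p + (0, d • v)) - φ p| ≤ ε * √|d|

theorem eventually_abs_mul_lt (c : ℝ) {η : ℝ} (hη : 0 < η) : ∀ᶠ d in 𝓝 (0 : ℝ), |d| * c < η := by
  have : Tendsto (fun d : ℝ => |d| * c) (𝓝 0) (𝓝 (|0| * c)) :=
    (continuous_abs.mul_const c).tendsto 0
  exact this.eventually_lt_const (by simpa using hη)

theorem eventually_sqrt_abs_mul_lt (c : ℝ) {η : ℝ} (hη : 0 < η) :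
    ∀ᶠ d in 𝓝 (0 : ℝ), √|d| * c < η := by
  have : Tendsto (fun d : ℝ => √|d| * c) (𝓝 0) (𝓝 (√|0| * c)) :=
    (Continuous.mul_const (by fun_prop) c).tendsto 0
  exact this.eventually_lt_const (by simpa using hη)

theorem LittleHolderAlong.zero (R : ℝ) : LittleHolderAlong φ a₀ R 0 := by
  intro r _ ε hε
  refine Eventually.of_forall fun d p _ _ => ?_
  rw [smul_zero, show ((0, 0) : G m h) = 0 from rfl, add_zero, sub_self, abs_zero]
  positivity

theorem LittleHolderAlong.add {R : ℝ} {v w : Fin h → ℝ} (hv : LittleHolderAlong φ a₀ R v)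
    (hw : LittleHolderAlong φ a₀ R w) : LittleHolderAlong φ a₀ R (v + w) := by
  intro r hr ε hε
  filter_upwards [hv r hr (ε / 2) (by positivity),
    hw ((r + R) / 2) (by linarith) (ε / 2) (by positivity),
    eventually_abs_mul_lt ‖v‖ (show 0 < (R - r) / 2 by linarith)] with d h1 h2 h3 p hp hpr
  have e1 := h1 p hp hpr
  have e2 := h2 (p + (0, d • v)) (add_vertical_mem_Wset hp _)
    ((norm_add_vertical_sub_le p a₀ v d).trans_lt (by linarith))
  have hsum : p + (0, d • (v + w)) = p + (0, d • v) + (0, d • w) := by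
    refine Prod.ext ?_ ?_ <;> simp [add_assoc]
  rw [hsum]
  have := abs_sub_le (φ (p + (0, d • v) + (0, d • w))) (φ (p + (0, d • v))) (φ p)
  linarith

theorem LittleHolderAlong.smul {R : ℝ} {v : Fin h → ℝ} (hv : LittleHolderAlong φ a₀ R v)
    (c : ℝ) : LittleHolderAlong φ a₀ R (c • v) := by
  intro r hr ε hε
  have hlim : Tendsto (fun d : ℝ => d * c) (𝓝 0) (𝓝 0) := by
    simpa using (continuous_mul_const c).tendsto (0 : ℝ)
  filter_upwards [hlim.eventually (hv r hr (ε / (√|c| + 1)) (by positivity))] with d h1 p hp hpr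
  rw [smul_smul]
  refine (h1 p hp hpr).trans ?_
  rw [abs_mul, Real.sqrt_mul (abs_nonneg d), div_mul_eq_mul_div, div_le_iff₀ (by positivity)]
  have := mul_nonneg hε.le (Real.sqrt_nonneg |d|)
  nlinarith [Real.sqrt_nonneg |c|]

/-- The directions of little-`1/2`-Hölder continuity form a subspace. -/
def littleHolderSubmodule (φ : G m h → ℝ) (a₀ : G m h) (R : ℝ) : Submodule ℝ (Fin h → ℝ) where
  carrier := {v | LittleHolderAlong φ a₀ R v}
  add_mem' := LittleHolderAlong.add
  zero_mem' := LittleHolderAlong.zero R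
  smul_mem' c _ hv := LittleHolderAlong.smul hv c

theorem flowPoint_add_vertical (j : Fin m) (p : G m h) (d t s : ℝ) :
    flowPoint B j (p + (0, d • coeffVec B j 0)) t (d + s) = flowPoint B j p t s := by
  refine Prod.ext ?_ ?_
  · simp [flowPoint]
  · ext i
    simp [flowPoint, coeffVec]
    ring

/-- Two integral curves of `D^φ_j` starting at points that differ in the direction
`coeffVec B j 0` would meet if `φ` differed too much at these points. -/
theorem LocalFlow.littleHolderAlong_coeffVec_zero (L : LocalFlow B φ ω a₀) {j : Fin m}
    (hj : j ≠ 0) : LittleHolderAlong φ a₀ L.R (coeffVec B j 0) := by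
  intro r hr ε hε
  have hη : 0 < ε ^ 2 / 12 := by positivity
  obtain ⟨δ₁, hδ₁, htaylor⟩ := L.taylor _ hη
  obtain ⟨δ₂, hδ₂, hunif⟩ := L.unif _ hη
  filter_upwards [eventually_abs_mul_lt ‖coeffVec B j 0‖ (show 0 < L.R - r by linarith),
    eventually_abs_mul_lt ‖coeffVec B j 0‖ hδ₂,
    eventually_sqrt_abs_mul_lt (2 / ε) L.τ_pos,
    eventually_sqrt_abs_mul_lt (2 / ε) hδ₁] with d hdR hdδ hTτ hTδ p hp hpr
  rcases eq_or_ne d 0 with rfl | hd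
  · rw [zero_smul, show ((0, 0) : G m h) = 0 from rfl, add_zero]
    simp
  set v := coeffVec B j 0 with hv
  set q : G m h := p + (0, d • v) with hq
  have hqW : q ∈ Wset m h := add_vertical_mem_Wset hp _
  have hqR : ‖q - a₀‖ < L.R := (norm_add_vertical_sub_le p a₀ v d).trans_lt (by linarith)
  have hpR : ‖p - a₀‖ < L.R := hpr.trans hr
  have hωpq : |ω q j - ω p j| ≤ ε ^ 2 / 12 := hunif j q hqW hqR p hp hpR (by
    rw [hq, add_sub_cancel_left, norm_vertical]
    exact hdδ)
  by_contra! hcon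
  set Δ := φ q - φ p with hΔ
  set T := √|d| * (2 / ε) with hT
  have hsqrt : 0 < √|d| := Real.sqrt_pos.2 (abs_pos.2 hd)
  have hTpos : 0 < T := by positivity
  have hΔpos : 0 < |Δ| := lt_trans (by positivity) hcon
  have hεT : ε * T = 2 * √|d| := by
    rw [hT]; field_simp
  have hclose : ∀ t, |t| ≤ T →
      |φ (flowPoint B j q t (L.F j q t)) - φ (flowPoint B j p t (L.F j p t)) - Δ| ≤ |Δ| / 2 := by
    intro t ht
    have e1 := abs_le.1 (htaylor j hj q hqW hqR t (ht.trans hTτ.le) (ht.trans_lt hTδ))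
    have e2 := abs_le.1 (htaylor j hj p hp hpR t (ht.trans hTτ.le) (ht.trans_lt hTδ))
    have e3 : |t * (ω q j - ω p j)| ≤ ε ^ 2 / 12 * |t| := by
      rw [abs_mul, mul_comm]
      gcongr
    have e3 := abs_le.1 e3
    have e4 : 3 * (ε ^ 2 / 12 * |t|) ≤ |Δ| / 2 := by
      have : ε ^ 2 * |t| ≤ ε ^ 2 * T := by gcongr
      nlinarith
    rw [abs_le]
    constructor <;> nlinarith
  obtain ⟨t, ht, htd⟩ := exists_eq_of_derivative_near_const
    (H := fun t => L.F j q t - L.F j p t) (T := T) (d := d) (Δ := Δ) hTpos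
    (by simp [L.F_zero j hj q hqW hqR, L.F_zero j hj p hp hpR])
    (fun t ht => (L.hasDerivAt j hj q hqW hqR t (ht.trans hTτ.le)).fun_sub
      (L.hasDerivAt j hj p hp hpR t (ht.trans hTτ.le)))
    hclose (by
      have hsq : √|d| * √|d| = |d| := Real.mul_self_sqrt (abs_nonneg d)
      have : ε * √|d| * T ≤ |Δ| * T := by gcongr
      nlinarith)
  have hmeet : flowPoint B j q t (L.F j q t) = flowPoint B j p t (L.F j p t) := by
    rw [show L.F j q t = d + L.F j p t by linarith, hq, hv, flowPoint_add_vertical]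
  have := hclose t ht
  rw [hmeet, sub_self, zero_sub, abs_neg] at this
  linarith

theorem LocalFlow.abs_F_sub_le (L : LocalFlow B φ ω a₀) {j : Fin m} (hj : j ≠ 0) {a : G m h}
    (ha : a ∈ Wset m h) (hn : ‖a - a₀‖ < L.R) {t : ℝ} (ht : |t| ≤ L.τ) :
    |L.F j a t - t * φ a| ≤ L.C * |t| * |t| := by
  have := abs_sub_le_of_hasDerivAt (F := L.F j a) (t := t) (c := φ a) (K := L.C * |t|)
    (fun s hs => L.hasDerivAt j hj a ha hn s (hs.trans ht))
    (fun s hs => (L.abs_sub_le j hj a ha hn s (hs.trans ht)).trans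
      (mul_le_mul_of_nonneg_left hs L.C_nonneg))
  rwa [L.F_zero j hj a ha hn, sub_zero] at this

theorem flowPoint_commutator (hskew : ∀ i, (B i).transpose = -B i) (l s : Fin m) (p : G m h)
    (t f₁ f₂ f₃ f₄ : ℝ) :
    flowPoint B s (flowPoint B l (flowPoint B s (flowPoint B l p t f₁) t f₂) (-t) f₃) (-t) f₄ +
        (0, (f₁ + f₃) • coeffVec B l 0) + (0, (f₂ + f₄) • coeffVec B s 0) =
      p + (0, t ^ 2 • coeffVec B l s) := by
  refine Prod.ext ?_ ?_
  · ext k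
    simp [flowPoint]
    ring
  · ext i
    have hls : B i s l = -B i l s := congrFun (coeffVec_swap hskew l s) i
    simp [flowPoint, coeffVec, add_mul, Finset.sum_add_distrib, Pi.single_apply,
      diag_eq_zero hskew, hls]
    ring

theorem abs_add_le_of_abs_sub_mul_le {x y f g K t : ℝ} (ht : 0 ≤ t)
    (hf : |f - t * x| ≤ K * t * t) (hg : |g - -t * y| ≤ K * t * t) (hxy : |x - y| ≤ 2 * (K * t)) :
    |f + g| ≤ 4 * K * t ^ 2 := by
  have h : |t * (x - y)| ≤ t * (2 * (K * t)) := by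
    rw [abs_mul, abs_of_nonneg ht]
    gcongr
  rw [abs_le] at hf hg h ⊢
  constructor <;> nlinarith

/-- Going around a small square in the directions `l`, `s` gives a vertical displacement, along
which `φ` varies little. -/
theorem LocalFlow.exists_commutator (L : LocalFlow B φ ω a₀)
    (hskew : ∀ i, (B i).transpose = -B i) {l s : Fin m} (hl : l ≠ 0) (hs : s ≠ 0)
    {ε : ℝ} (hε : 0 < ε) :
    ∃ δ > 0, ∀ t, 0 ≤ t → t < δ → ∀ p ∈ Wset m h, ‖p - a₀‖ + t * (4 * L.C) < L.R →
      ∃ q ∈ Wset m h, ∃ α β : ℝ,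
        q + (0, α • coeffVec B l 0) + (0, β • coeffVec B s 0) =
          p + (0, t ^ 2 • coeffVec B l s) ∧
        |α| ≤ 4 * L.C * t ^ 2 ∧ |β| ≤ 4 * L.C * t ^ 2 ∧ ‖q - a₀‖ ≤ ‖p - a₀‖ + t * (4 * L.C) ∧
        |φ q - φ p| ≤ ε * t := by
  have hη : 0 < ε / 6 := by positivity
  obtain ⟨δ₁, hδ₁, htaylor⟩ := L.taylor _ hη
  obtain ⟨δ₂, hδ₂, hunif⟩ := L.unif _ hη
  have hC := L.C_nonneg
  refine ⟨min (min L.τ δ₁) (δ₂ / (2 * L.C + 1)),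
    by have := L.τ_pos; positivity, fun t ht0 htδ p hp hpR => ?_⟩
  have htτ : t ≤ L.τ := htδ.le.trans ((min_le_left _ _).trans (min_le_left _ _))
  have htδ₁ : t < δ₁ := htδ.trans_le ((min_le_left _ _).trans (min_le_right _ _))
  have htδ₂ : 2 * L.C * t < δ₂ := by
    have := (lt_div_iff₀ (by positivity)).1 (htδ.trans_le (min_le_right _ _))
    nlinarith
  have habs : |t| = t := abs_of_nonneg ht0
  have habs' : |-t| = t := by rw [abs_neg, habs]
  have hCt : 0 ≤ L.C * t := by positivity
  have move : ∀ j ≠ 0, ∀ a ∈ Wset m h, ‖a - a₀‖ < L.R → ∀ σ : ℝ, |σ| = t →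
      flowPoint B j a σ (L.F j a σ) ∈ Wset m h ∧
      ‖flowPoint B j a σ (L.F j a σ) - a‖ ≤ L.C * t ∧
      |φ (flowPoint B j a σ (L.F j a σ)) - φ a| ≤ L.C * t ∧
      |φ (flowPoint B j a σ (L.F j a σ)) - φ a - σ * ω a j| ≤ ε / 6 * t ∧
      |L.F j a σ - σ * φ a| ≤ L.C * t * t := by
    intro j hj a ha hn σ hσ
    have hστ : |σ| ≤ L.τ := hσ.le.trans htτ
    refine ⟨flowPoint_mem_Wset hj ha _ _, ?_, ?_, ?_, ?_⟩
    · simpa [hσ] using L.norm_sub_le j hj a ha hn σ hστ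
    · simpa [hσ] using L.abs_sub_le j hj a ha hn σ hστ
    · simpa [hσ] using htaylor j hj a ha hn σ hστ (by rwa [hσ])
    · simpa [hσ] using L.abs_F_sub_le hj ha hn hστ
  have tri : ∀ a b c : G m h, ‖a - c‖ ≤ ‖a - b‖ + ‖b - c‖ :=
    fun a b c => norm_sub_le_norm_sub_add_norm_sub a b c
  have hp0 : ‖p - a₀‖ < L.R := by linarith
  obtain ⟨h1W, h1n, h1φ, h1ω, h1F⟩ := move l hl p hp hp0 t habs
  set f₁ := L.F l p t
  set p₁ := flowPoint B l p t f₁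
  have h1R : ‖p₁ - a₀‖ < L.R := by linarith [tri p₁ p a₀]
  obtain ⟨h2W, h2n, h2φ, h2ω, h2F⟩ := move s hs p₁ h1W h1R t habs
  set f₂ := L.F s p₁ t
  set p₂ := flowPoint B s p₁ t f₂
  have h2R : ‖p₂ - a₀‖ < L.R := by linarith [tri p₁ p a₀, tri p₂ p₁ a₀]
  obtain ⟨h3W, h3n, h3φ, h3ω, h3F⟩ := move l hl p₂ h2W h2R (-t) habs'
  set f₃ := L.F l p₂ (-t)
  set p₃ := flowPoint B l p₂ (-t) f₃
  have h3R : ‖p₃ - a₀‖ < L.R := by linarith [tri p₁ p a₀, tri p₂ p₁ a₀, tri p₃ p₂ a₀]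
  obtain ⟨h4W, h4n, h4φ, h4ω, h4F⟩ := move s hs p₃ h3W h3R (-t) habs'
  set f₄ := L.F s p₃ (-t)
  set p₄ := flowPoint B s p₃ (-t) f₄
  have hω : ∀ j, ∀ a ∈ Wset m h, ‖a - a₀‖ < L.R → ∀ b ∈ Wset m h, ‖b - a₀‖ < L.R →
      ‖b - a‖ ≤ 2 * L.C * t → |t * (ω a j - ω b j)| ≤ ε / 6 * t := by
    intro j a ha haR b hb hbR hab
    rw [abs_mul, habs, mul_comm]
    gcongr
    exact hunif j a ha haR b hb hbR (by rw [norm_sub_rev]; linarith)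
  have hωl := hω l p hp hp0 p₂ h2W h2R (by linarith [tri p₂ p₁ p])
  have hωs := hω s p₁ h1W h1R p₃ h3W h3R (by linarith [tri p₃ p₂ p₁])
  refine ⟨p₄, h4W, f₁ + f₃, f₂ + f₄, flowPoint_commutator hskew l s p t f₁ f₂ f₃ f₄, ?_, ?_, ?_, ?_⟩
  · refine abs_add_le_of_abs_sub_mul_le ht0 h1F h3F ?_
    rw [abs_le] at h1φ h2φ ⊢
    constructor <;> linarith
  · refine abs_add_le_of_abs_sub_mul_le ht0 h2F h4F ?_
    rw [abs_le] at h2φ h3φ ⊢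
    constructor <;> linarith
  · linarith [tri p₁ p a₀, tri p₂ p₁ a₀, tri p₃ p₂ a₀, tri p₄ p₃ a₀]
  · rw [abs_le] at h1ω h2ω h3ω h4ω hωl hωs ⊢
    constructor <;> linarith

theorem LocalFlow.eventually_commutator (L : LocalFlow B φ ω a₀)
    (hskew : ∀ i, (B i).transpose = -B i) {l s : Fin m} (hl : l ≠ 0) (hs : s ≠ 0)
    {r : ℝ} (hr : r < L.R) {ε : ℝ} (hε : 0 < ε) :
    ∀ᶠ d in 𝓝 (0 : ℝ), 0 ≤ d → ∀ p ∈ Wset m h, ‖p - a₀‖ < r →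
      |φ (p + (0, d • coeffVec B l s)) - φ p| ≤ ε * √|d| := by
  have hC := L.C_nonneg
  set c := √(4 * L.C) with hc
  have hc0 : 0 ≤ c := Real.sqrt_nonneg _
  have hη : 0 < ε / (3 * (c + 1)) := by positivity
  have hr' : (r + L.R) / 2 < L.R := by linarith
  obtain ⟨ρl, hρl, hHl⟩ := Metric.eventually_nhds_iff.1
    (L.littleHolderAlong_coeffVec_zero hl _ hr' _ hη)
  obtain ⟨ρs, hρs, hHs⟩ := Metric.eventually_nhds_iff.1
    (L.littleHolderAlong_coeffVec_zero hs _ hr' _ hη)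
  obtain ⟨δ, hδ, hcomm⟩ := L.exists_commutator hskew hl hs (show 0 < ε / 3 by positivity)
  have hgap : 0 < (L.R - r) / 4 := by linarith
  filter_upwards [eventually_sqrt_abs_mul_lt 1 hδ, eventually_sqrt_abs_mul_lt (4 * L.C) hgap,
    eventually_abs_mul_lt (4 * L.C) hρl, eventually_abs_mul_lt (4 * L.C) hρs,
    eventually_abs_mul_lt (4 * L.C * ‖coeffVec B l 0‖) hgap] with d h1 h2 h3 h4 h5 hd p hp hpr
  have hdd : √|d| ^ 2 = |d| := Real.sq_sqrt (abs_nonneg d)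
  obtain ⟨q, hq, α, β, hqp, hα, hβ, hqn, hφ⟩ := hcomm √|d| (Real.sqrt_nonneg _) (by linarith)
    p hp (by linarith)
  rw [hdd] at hqp hα hβ
  rw [abs_of_nonneg hd] at hqp
  have hstep : ∀ x : ℝ, |x| ≤ 4 * L.C * |d| → ε / (3 * (c + 1)) * √|x| ≤ ε / 3 * √|d| := by
    intro x hx
    have : √|x| ≤ c * √|d| := by
      rw [hc, ← Real.sqrt_mul (by positivity)]
      exact Real.sqrt_le_sqrt hx
    calc ε / (3 * (c + 1)) * √|x| ≤ ε / (3 * (c + 1)) * ((c + 1) * √|d|) := by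
          gcongr
          nlinarith [Real.sqrt_nonneg |d|]
      _ = ε / 3 * √|d| := by field_simp
  have hα' : |α| * ‖coeffVec B l 0‖ < (L.R - r) / 4 := by
    have := mul_le_mul_of_nonneg_right hα (norm_nonneg (coeffVec B l 0))
    nlinarith
  set q' := q + (0, α • coeffVec B l 0) with hq'
  have e1 := (hHl (y := α) (by rw [Real.dist_0_eq_abs]; nlinarith) q hq
    (by linarith)).trans (hstep α hα)
  have e2 := (hHs (y := β) (by rw [Real.dist_0_eq_abs]; nlinarith) q'
    (add_vertical_mem_Wset hq _)
    ((norm_add_vertical_sub_le q a₀ _ α).trans_lt (by linarith))).trans (hstep β hβ)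
  rw [hqp] at e2
  rw [abs_le] at e1 e2 hφ ⊢
  constructor <;> linarith

theorem LocalFlow.littleHolderAlong_coeffVec (L : LocalFlow B φ ω a₀)
    (hskew : ∀ i, (B i).transpose = -B i) {l s : Fin m} (hl : l ≠ 0) (hs : s ≠ 0) :
    LittleHolderAlong φ a₀ L.R (coeffVec B l s) := by
  intro r hr ε hε
  have hneg : Tendsto (fun d : ℝ => -d) (𝓝 0) (𝓝 0) := by
    simpa using (continuous_neg (G := ℝ)).tendsto 0
  filter_upwards [L.eventually_commutator hskew hl hs hr hε,
    hneg.eventually (L.eventually_commutator hskew hs hl hr hε)] with d h1 h2 p hp hpr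
  rcases le_total 0 d with hd | hd
  · exact h1 hd p hp hpr
  · have := h2 (by linarith) p hp hpr
    rwa [coeffVec_swap hskew l s, neg_smul_neg, abs_neg] at this

theorem LocalFlow.coeffVec_mem (L : LocalFlow B φ ω a₀)
    (hskew : ∀ i, (B i).transpose = -B i) (j k : Fin m) :
    coeffVec B j k ∈ littleHolderSubmodule φ a₀ L.R := by
  have hz : ∀ l, coeffVec B l 0 ∈ littleHolderSubmodule φ a₀ L.R := by
    intro l
    by_cases hl : l = 0
    · have : coeffVec B l 0 = 0 := by
        ext i
        simp [hl, coeffVec, diag_eq_zero hskew]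
      rw [this]
      exact Submodule.zero_mem _
    · exact L.littleHolderAlong_coeffVec_zero hl
  by_cases hk : k = 0
  · rw [hk]
    exact hz j
  by_cases hj : j = 0
  · rw [hj, coeffVec_swap hskew k 0]
    exact Submodule.neg_mem _ (hz k)
  · exact L.littleHolderAlong_coeffVec hskew hj hk

end VerticalHolder

/-- In a step-2 Carnot group, if `D^φφ = ω` in the broad* sense on `U` for
some continuous `ω`, then `φ` is vertically broad* Hölder on `U`. -/
theorem statement17 (m h : ℕ) [NeZero m] (hm : 2 ≤ m) (hh : 1 ≤ h)
    (B : Fin h → Matrix (Fin m) (Fin m) ℝ)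
    (hskew : ∀ i, (B i).transpose = - B i) (hBli : LinearIndependent ℝ B)
    (U : Set (G m h)) (hUW : U ⊆ Wset m h) (hUopen : RelOpen m h U)
    (φ : G m h → ℝ) (hφ : ContinuousOn φ U)
    (ω : G m h → Fin m → ℝ)
    (hω : ∀ j : Fin m, j ≠ 0 → ContinuousOn (fun w => ω w j) U)
    (hbroad : IsBroadStar B U φ ω) :
    VertHolder m h U φ := by
  intro a₀ ha₀
  set ω' : G m h → Fin m → ℝ := fun w j => if j = 0 then 0 else ω w j with hω'
  have hω'c : ContinuousOn ω' U := by
    refine continuousOn_pi.2 fun j => ?_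
    by_cases hj : j = 0
    · simpa [hω', hj] using continuousOn_const
    · simpa [hω', hj] using hω j hj
  have hbroad' : IsBroadStar B U φ ω' := by
    intro b hb
    obtain ⟨δ₁, δ₂, h1, h2, hE⟩ := hbroad b hb
    refine ⟨δ₁, δ₂, h1, h2, fun j hj => ?_⟩
    simpa only [hω', if_neg hj] using hE j hj
  obtain ⟨L, hLU⟩ := nonempty_localFlow hskew hUW hUopen hφ hω'c hbroad' ha₀
  have htop := eq_top_of_coeffVec_mem hBli (L.coeffVec_mem hskew)
  have hR := L.R_pos
  have hWclosed : IsClosed (Wset m h) := isClosed_eq (by fun_prop) continuous_const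
  have hcl : closure (Metric.ball a₀ (L.R / 2) ∩ Wset m h) ⊆
      Metric.closedBall a₀ (L.R / 2) ∩ Wset m h :=
    closure_minimal (Set.inter_subset_inter_left _ Metric.ball_subset_closedBall)
      (Metric.isClosed_closedBall.inter hWclosed)
  refine ⟨Metric.ball a₀ (L.R / 2) ∩ Wset m h, ⟨_, Metric.isOpen_ball, rfl⟩,
    ⟨Metric.mem_ball_self (by positivity), hUW ha₀⟩, ?_, ?_, ?_⟩
  · exact ((isCompact_closedBall a₀ (L.R / 2)).inter_right hWclosed).of_isClosed_subset
      isClosed_closure hcl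
  · intro p hp
    have := mem_closedBall_iff_norm.1 (hcl hp).1
    exact hLU p (hcl hp).2 (by linarith)
  · intro i ε hε
    have hi : Pi.single i 1 ∈ littleHolderSubmodule φ a₀ L.R := htop ▸ Submodule.mem_top
    obtain ⟨ρ, hρ, hd⟩ := Metric.eventually_nhds_iff.1 (hi (L.R / 2) (by linarith) ε hε)
    refine ⟨ρ / 2, by positivity, fun p hp q hq hx hy _ hle => ?_⟩
    have hpq : p = q + (0, (p.2 i - q.2 i) • Pi.single i 1) := by
      refine Prod.ext (by simp [hx]) ?_
      ext k
      by_cases hk : k = i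
      · simp [hk]
      · simp [hk, hy k hk]
    have := hd (y := p.2 i - q.2 i) (by rw [Real.dist_0_eq_abs]; linarith) q hq.2
      (mem_ball_iff_norm.1 hq.1)
    rwa [← hpq] at this

end Step2
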